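/- Let f : ℝ → ℂ be continuous, Λ*-periodic, real-analytic on ℝ \ S for a discrete closed set S, and suppose near each α₀ ∈ S we have f(α) = v(α) + √(α - α₀)·w(α) with v, w analytic near α₀ (√ denoting a fixed branch with s(α)² = α - α₀). Then f is (1/2)-Hölder continuous on ℝ: there exists C > 0 with |f(α) - f(β)| ≤ C|α - β|^{1/2} for all α, β ∈ ℝ. -/

import Mathlib

/-- If the inner product of two complex numbers is nonnegative, their squares control their
distance. -/
theorem norm_sub_sq_le_norm_sq_sub_sq {a b : ℂ} (h : 0 ≤ a.re * b.re + a.im * b.im) :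
    ‖a - b‖ ^ 2 ≤ ‖a ^ 2 - b ^ 2‖ := by
  have h1 : ‖a - b‖ ≤ ‖a + b‖ := by
    rw [← sq_le_sq₀ (norm_nonneg _) (norm_nonneg _), Complex.sq_norm, Complex.sq_norm,
      Complex.normSq_apply, Complex.normSq_apply]
    simp only [Complex.sub_re, Complex.sub_im, Complex.add_re, Complex.add_im]
    nlinarith
  have h2 : a ^ 2 - b ^ 2 = (a - b) * (a + b) := by ring
  rw [h2, norm_mul, sq]
  gcongr

/-- For orthogonal complex numbers, the distance of the squares bounds the norms. -/
theorem norm_sq_le_norm_sq_sub_sq {a b : ℂ} (h : a.re * b.re + a.im * b.im = 0) :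
    ‖a‖ ^ 2 ≤ ‖a ^ 2 - b ^ 2‖ := by
  have h1 : ‖a‖ ^ 2 ≤ ‖a - b‖ ^ 2 := by
    rw [Complex.sq_norm, Complex.sq_norm, Complex.normSq_apply, Complex.normSq_apply]
    simp only [Complex.sub_re, Complex.sub_im]
    nlinarith [sq_nonneg b.re, sq_nonneg b.im]
  exact h1.trans (norm_sub_sq_le_norm_sq_sub_sq h.ge)

/-- A continuous complex-valued square root of a Lipschitz function on an interval is
`1/2`-Hölder. -/
theorem norm_sub_le_of_sq_lipschitz {I : Set ℝ} (hI : I.OrdConnected) {g : ℝ → ℂ}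
    (hg : ContinuousOn g I) {L : ℝ} (hL : 0 ≤ L)
    (hlip : ∀ x ∈ I, ∀ y ∈ I, ‖g x ^ 2 - g y ^ 2‖ ≤ L * |x - y|) {x y : ℝ}
    (hx : x ∈ I) (hy : y ∈ I) : ‖g x - g y‖ ≤ 3 * √L * √|x - y| := by
  have key : ‖g x - g y‖ ^ 2 ≤ 9 * (L * |x - y|) := by
    have hLxy : 0 ≤ L * |x - y| := by positivity
    by_cases h : 0 ≤ (g x).re * (g y).re + (g x).im * (g y).im
    · linarith [norm_sub_sq_le_norm_sq_sub_sq h, hlip x hx y hy]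
    push Not at h
    have hsub : Set.uIcc x y ⊆ I := hI.uIcc_subset hx hy
    have hgc := hg.mono hsub
    have hc : ContinuousOn (fun t => (g x).re * (g t).re + (g x).im * (g t).im)
        (Set.uIcc x y) :=
      (continuousOn_const.mul (Complex.continuous_re.comp_continuousOn hgc)).add
        (continuousOn_const.mul (Complex.continuous_im.comp_continuousOn hgc))
    obtain ⟨t, ht, ht0⟩ := intermediate_value_uIcc hc
      (Set.mem_uIcc.2 (Or.inr ⟨h.le, add_nonneg (mul_self_nonneg _) (mul_self_nonneg _)⟩))
    have hxt : |x - t| ≤ |x - y| := by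
      rw [abs_sub_comm x t, abs_sub_comm x y]
      exact Set.abs_sub_left_of_mem_uIcc ht
    have h1 : ‖g x‖ ^ 2 ≤ L * |x - y| :=
      (norm_sq_le_norm_sq_sub_sq ht0).trans ((hlip x hx t (hsub ht)).trans (by gcongr))
    have h2 : ‖g y‖ ^ 2 ≤ 2 * (L * |x - y|) := by
      have h3 := norm_sub_norm_le (g y ^ 2) (g x ^ 2)
      rw [norm_sub_rev, norm_pow, norm_pow] at h3
      linarith [hlip x hx y hy]
    have h4 := norm_sub_le (g x) (g y)
    nlinarith [sq_nonneg (‖g x‖ - ‖g y‖), norm_nonneg (g x - g y), norm_nonneg (g x),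
      norm_nonneg (g y)]
  have h9 : (3 * √L * √|x - y|) ^ 2 = 9 * (L * |x - y|) := by
    rw [mul_pow, mul_pow, Real.sq_sqrt hL, Real.sq_sqrt (abs_nonneg _)]
    ring
  rw [← h9] at key
  exact (sq_le_sq₀ (norm_nonneg _) (by positivity)).1 key

/-- A function of the form `v + g` with `v` and `g ^ 2` analytic at a point and `g` continuous
nearby is `1/2`-Hölder near that point. -/
theorem exists_ball_holder_of_analyticAt_add {f v h : ℝ → ℂ} {a : ℝ} (hf : Continuous f)
    (hv : AnalyticAt ℝ v a) (hh : AnalyticAt ℝ h a)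
    (hfv : ∀ᶠ x in nhds a, (f x - v x) ^ 2 = h x) :
    ∃ r > 0, ∃ C ≥ 0, ∀ x ∈ Metric.ball a r, ∀ y ∈ Metric.ball a r,
      ‖f x - f y‖ ≤ C * √|x - y| := by
  obtain ⟨K, t, ht, hK⟩ := (hv.contDiffAt (n := 1)).exists_lipschitzOnWith
  obtain ⟨L, u, hu, hL⟩ := (hh.contDiffAt (n := 1)).exists_lipschitzOnWith
  obtain ⟨ρ, hρ, hball⟩ := Metric.mem_nhds_iff.1 (Filter.inter_mem (Filter.inter_mem ht hu) hfv)
  have hr1 : min ρ (1 / 2) ≤ 1 / 2 := min_le_right _ _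
  refine ⟨min ρ (1 / 2), by positivity, K + 3 * √L, by positivity, fun x hx y hy => ?_⟩
  have hsub : Metric.ball a (min ρ (1 / 2)) ⊆ t ∩ u ∩ {x | (f x - v x) ^ 2 = h x} :=
    (Metric.ball_subset_ball (min_le_left _ _)).trans hball
  have hvc : ContinuousOn v (Metric.ball a (min ρ (1 / 2))) :=
    hK.continuousOn.mono fun z hz => (hsub hz).1.1
  have hg := norm_sub_le_of_sq_lipschitz (I := Metric.ball a (min ρ (1 / 2)))
    (g := fun z => f z - v z) (L := L) (convex_ball _ _).ordConnected
    (hf.continuousOn.sub hvc) L.2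
    (fun p hp q hq => by
      have e1 : (f p - v p) ^ 2 = h p := (hsub hp).2
      have e2 : (f q - v q) ^ 2 = h q := (hsub hq).2
      simpa [e1, e2, dist_eq_norm] using hL.dist_le_mul p (hsub hp).1.2 q (hsub hq).1.2) hx hy
  have hv' : ‖v x - v y‖ ≤ K * |x - y| := by
    simpa [dist_eq_norm] using hK.dist_le_mul x (hsub hx).1.1 y (hsub hy).1.1
  have hxy : |x - y| ≤ √|x - y| := by
    refine Real.le_sqrt_of_sq_le ?_
    have : |x - y| ≤ 1 := by
      rw [Metric.mem_ball, Real.dist_eq, abs_lt] at hx hy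
      rw [abs_le]
      constructor <;> linarith
    nlinarith [abs_nonneg (x - y)]
  calc ‖f x - f y‖ = ‖(v x - v y) + ((f x - v x) - (f y - v y))‖ := by congr 1; ring
    _ ≤ ‖v x - v y‖ + ‖(f x - v x) - (f y - v y)‖ := norm_add_le _ _
    _ ≤ K * √|x - y| + 3 * √L * √|x - y| :=
      add_le_add (hv'.trans (mul_le_mul_of_nonneg_left hxy K.2)) hg
    _ = (K + 3 * √L) * √|x - y| := by ring

/-- A continuous periodic function that is `1/2`-Hölder near every point is globally
`1/2`-Hölder. -/
theorem Function.Periodic.exists_holder_of_locally {f : ℝ → ℂ} {T : ℝ}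
    (hper : Function.Periodic f T) (hT : 0 < T) (hf : Continuous f)
    (hloc : ∀ a, ∃ r > 0, ∃ C ≥ 0, ∀ x ∈ Metric.ball a r, ∀ y ∈ Metric.ball a r,
      ‖f x - f y‖ ≤ C * √|x - y|) :
    ∃ C > 0, ∀ x y : ℝ, ‖f x - f y‖ ≤ C * √|x - y| := by
  have hunif : ∃ r > 0, ∃ C ≥ 0, ∀ x ∈ Set.Icc 0 T, ∀ y, |x - y| < r →
      ‖f x - f y‖ ≤ C * √|x - y| := by
    refine isCompact_Icc.induction_on (p := fun s => ∃ r > 0, ∃ C ≥ 0, ∀ x ∈ s, ∀ y,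
      |x - y| < r → ‖f x - f y‖ ≤ C * √|x - y|) ⟨1, one_pos, 0, le_rfl, by simp⟩ ?_ ?_ ?_
    · rintro s t hst ⟨r, hr, C, hC, h⟩
      exact ⟨r, hr, C, hC, fun x hx => h x (hst hx)⟩
    · rintro s t ⟨r, hr, C, hC, h⟩ ⟨r', hr', C', hC', h'⟩
      refine ⟨min r r', lt_min hr hr', max C C', le_max_of_le_left hC, ?_⟩
      rintro x (hx | hx) y hxy
      · exact (h x hx y (hxy.trans_le (min_le_left _ _))).trans (by gcongr; exact le_max_left _ _)
      · exact (h' x hx y (hxy.trans_le (min_le_right _ _))).trans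
          (by gcongr; exact le_max_right _ _)
    · intro a _
      obtain ⟨r, hr, C, hC, h⟩ := hloc a
      refine ⟨Metric.ball a (r / 2),
        mem_nhdsWithin_of_mem_nhds (Metric.ball_mem_nhds a (half_pos hr)),
        r / 2, half_pos hr, C, hC, fun x hx y hxy => h x ?_ y ?_⟩
      · exact Metric.ball_subset_ball (by linarith) hx
      · rw [Metric.mem_ball, Real.dist_eq, abs_lt] at *
        constructor <;> linarith
  obtain ⟨r, hr, C, hC, h⟩ := hunif
  obtain ⟨M, hM⟩ := (hper.isBounded_of_continuous hT.ne' hf).exists_norm_le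
  have hM' : ∀ x, ‖f x‖ ≤ M := fun x => hM _ (Set.mem_range_self x)
  have hM0 : 0 ≤ M := (norm_nonneg _).trans (hM' 0)
  refine ⟨C + 2 * M / √r + 1, by positivity, fun x y => ?_⟩
  rcases lt_or_ge |x - y| r with hxy | hxy
  · have hk := sub_toIcoDiv_zsmul_mem_Ico hT 0 x
    set k := toIcoDiv hT 0 x
    rw [zero_add] at hk
    have hs : x - k • T - (y - k • T) = x - y := by ring
    have hh := h (x - k • T) (Set.Ico_subset_Icc_self hk) (y - k • T) (by rwa [hs])
    rw [hs, hper.sub_zsmul_eq, hper.sub_zsmul_eq] at hh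
    refine hh.trans (mul_le_mul_of_nonneg_right ?_ (Real.sqrt_nonneg _))
    have : 0 ≤ 2 * M / √r := by positivity
    linarith
  · have hsr : 0 < √r := Real.sqrt_pos.2 hr
    calc ‖f x - f y‖ ≤ ‖f x‖ + ‖f y‖ := norm_sub_le _ _
      _ ≤ 2 * M := by linarith [hM' x, hM' y]
      _ = 2 * M / √r * √r := by field_simp
      _ ≤ 2 * M / √r * √|x - y| := by gcongr
      _ ≤ (C + 2 * M / √r + 1) * √|x - y| := by gcongr; linarith


theorem holder_regularity_of_sqrt_singular_function (Λs : ℝ) (hΛs : 0 < Λs)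
    (S : Set ℝ) (f : ℝ → ℂ)
    (hper : Function.Periodic f Λs)
    (hcont : Continuous f)
    (hSclosed : IsClosed S)
    (hSinv : ∀ α : ℝ, α ∈ S ↔ α + Λs ∈ S)
    (hSfin : (S ∩ Set.Icc 0 Λs).Finite)
    (hana : AnalyticOnNhd ℝ f Sᶜ)
    (hloc : ∀ α₀ ∈ S, ∃ δ > 0, ∃ v w s : ℝ → ℂ,
      AnalyticOnNhd ℝ v (Set.Ioo (α₀ - δ) (α₀ + δ)) ∧
      AnalyticOnNhd ℝ w (Set.Ioo (α₀ - δ) (α₀ + δ)) ∧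
      ∀ α ∈ Set.Ioo (α₀ - δ) (α₀ + δ),
        s α ^ 2 = (α : ℂ) - (α₀ : ℂ) ∧
        ‖s α‖ = Real.sqrt |α - α₀| ∧
        f α = v α + s α * w α) :
    ∃ C > 0, ∀ α β : ℝ, ‖f α - f β‖ ≤ C * Real.sqrt |α - β| := by
  refine hper.exists_holder_of_locally hΛs hcont fun a => ?_
  by_cases ha : a ∈ S
  · obtain ⟨δ, hδ, v, w, s, hv, hw, h⟩ := hloc a ha
    have haI : a ∈ Set.Ioo (a - δ) (a + δ) := ⟨by linarith, by linarith⟩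
    have hid : AnalyticAt ℝ (fun x : ℝ => (x : ℂ) - (a : ℂ)) a :=
      (Complex.ofRealCLM.analyticAt a).sub analyticAt_const
    refine exists_ball_holder_of_analyticAt_add hcont (hv a haI) (hid.mul ((hw a haI).pow 2)) ?_
    filter_upwards [Ioo_mem_nhds haI.1 haI.2] with x hx
    obtain ⟨h1, -, h3⟩ := h x hx
    simp only [Pi.mul_apply, Pi.pow_apply]
    rw [h3, ← h1]
    ring
  · exact exists_ball_holder_of_analyticAt_add hcont (hana a ha) analyticAt_const
      (h := fun _ => 0) (Filter.Eventually.of_forall fun x => by simp)
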